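/- arXiv:2110.15395 — 2 statements merged into one kernel-verified Lean document; each statement's English description precedes it below -/
import Mathlib

section
/- For every update sequence s₀, s₁, …, s_m starting from the initial state s₀ = (∅, 0), writing s_m = (ŷ_m, c_m): if ŷ_m ≠ y then g − b ≤ n − 1, and if ŷ_m = y then g − b = n + c_m (in particular g − b ≤ n + c_m always holds). -/
/-- Operations: confirm (•), append a bit, delete the last bit. -/
inductive Op where
  | confirm : Op
  | app : Bool → Op
  | del : Op
  deriving DecidableEq

/-- Apply an operation to a state `(yh, c)`. -/
def applyOp : List Bool × ℕ → Op → List Bool × ℕ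
  | (yh, c), Op.confirm => (yh, c + 1)
  | (yh, c + 1), _ => (yh, c)
  | (yh, 0), Op.app b => (yh ++ [b], 0)
  | (yh, 0), Op.del => (yh.dropLast, 0)

/-- The correct operation `op_y(yh)` with respect to the target string `y`. -/
def opy (y yh : List Bool) : Op :=
  if yh = y then Op.confirm
  else if h : yh.length < y.length ∧ yh <+: y then Op.app (y.get ⟨yh.length, h.1⟩)
  else Op.del

/-- The good step: apply the correct operation. -/
def goodStep (y : List Bool) (s : List Bool × ℕ) : List Bool × ℕ :=
  applyOp s (opy y s.1)

/-- Length of the longest common prefix of two boolean strings. -/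
def lcp : List Bool → List Bool → ℕ
  | a :: as, b :: bs => if a = b then lcp as bs + 1 else 0
  | _, _ => 0

theorem lcp_eq_length_of_prefix {x y : List Bool} (h : x <+: y) : lcp x y = x.length := by
  induction x generalizing y with
  | nil => simp [lcp]
  | cons a x ih =>
    obtain ⟨t, rfl⟩ := h
    simpa [lcp] using ih (List.prefix_append x t)

theorem lcp_le_length_left (x y : List Bool) : lcp x y ≤ x.length := by
  induction x generalizing y with
  | nil => simp [lcp]
  | cons a x ih => cases y <;> simp only [lcp] <;> grind

theorem lcp_le_length_right (x y : List Bool) : lcp x y ≤ y.length := by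
  induction x generalizing y with
  | nil => simp [lcp]
  | cons a x ih => cases y <;> simp only [lcp] <;> grind

theorem prefix_of_lcp_eq_length {x y : List Bool} (h : lcp x y = x.length) : x <+: y := by
  induction x generalizing y with
  | nil => simp
  | cons a x ih =>
    cases y with
    | nil => simp [lcp] at h
    | cons b y =>
      by_cases hab : a = b
      · subst hab
        simpa using ih (by simpa [lcp] using h)
      · simp [lcp, hab] at h

theorem lcp_append_singleton_of_not_prefix {x y : List Bool} {b : Bool}
    (h : ¬ x ++ [b] <+: y) : lcp (x ++ [b]) y = lcp x y := by
  induction x generalizing y with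
  | nil => cases y <;> simp_all [lcp]
  | cons a x ih =>
    cases y with
    | nil => simp [lcp]
    | cons c y =>
      by_cases hac : a = c
      · subst hac
        simpa [lcp] using ih (by simpa using h)
      · simp [lcp, hac]

/-- The number of good updates minus the number of bad updates needed to reach a state. -/
def progress (y : List Bool) (s : List Bool × ℕ) : ℤ :=
  2 * lcp s.1 y - s.1.length + if s.1 = y then (s.2 : ℤ) else -s.2

theorem progress_self (y : List Bool) (c : ℕ) : progress y (y, c) = y.length + c := by
  simp only [progress, lcp_eq_length_of_prefix List.prefix_rfl, if_true]
  ring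

theorem progress_le_of_ne {y : List Bool} {s : List Bool × ℕ} (h : s.1 ≠ y) :
    progress y s ≤ y.length - 1 := by
  have hl := lcp_le_length_left s.1 y
  have hr := lcp_le_length_right s.1 y
  have hlt : ¬ (lcp s.1 y = s.1.length ∧ lcp s.1 y = y.length) := fun ⟨h₁, h₂⟩ =>
    h ((prefix_of_lcp_eq_length h₁).eq_of_length (h₁.symm.trans h₂))
  simp only [progress, if_neg h]
  omega

theorem progress_append_singleton (y x : List Bool) (b : Bool) :
    progress y (x ++ [b], 0) = progress y (x, 0) + if x ++ [b] <+: y then 1 else -1 := by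
  by_cases h : x ++ [b] <+: y
  · have hx : x <+: y := (List.prefix_append x [b]).trans h
    simp [progress, lcp_eq_length_of_prefix h, lcp_eq_length_of_prefix hx, h]
    ring
  · simp [progress, lcp_append_singleton_of_not_prefix h, h]
    ring

theorem opy_eq_confirm_iff {y x : List Bool} : opy y x = Op.confirm ↔ x = y := by
  unfold opy
  split_ifs <;> simp_all

theorem opy_eq_app_iff {y x : List Bool} {b : Bool} :
    opy y x = Op.app b ↔ x ++ [b] <+: y := by
  unfold opy
  split_ifs with h₁ h₂
  · subst h₁
    simpa using fun h : x ++ [b] <+: x => absurd h.length_le (by simp)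
  · obtain ⟨t, rfl⟩ := h₂.2
    cases t <;> simp_all [eq_comm]
  · simp only [false_iff]
    intro h
    exact h₂ ⟨by simpa using h.length_le, (List.prefix_append x [b]).trans h⟩

theorem opy_eq_del_iff {y x : List Bool} : opy y x = Op.del ↔ ¬ x <+: y := by
  unfold opy
  split_ifs with h₁ h₂
  · simp [h₁]
  · simp [h₂.2]
  · simp only [true_iff]
    intro h
    exact h₂ ⟨lt_of_le_of_ne h.length_le fun hl => h₁ (h.eq_of_length hl), h⟩

theorem applyOp_succ {x : List Bool} {c : ℕ} {σ : Op} (h : σ ≠ Op.confirm) :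
    applyOp (x, c + 1) σ = (x, c) := by
  cases σ <;> simp_all [applyOp]

theorem applyOp_eq_confirm_iff {x : List Bool} {c : ℕ} {τ : Op} :
    (x, c + 1) = applyOp (x, c) τ ↔ τ = Op.confirm := by
  cases τ <;> cases c <;> simp [applyOp] <;> omega

theorem applyOp_eq_app_iff {x : List Bool} {b : Bool} {τ : Op} :
    (x ++ [b], 0) = applyOp (x, 0) τ ↔ τ = Op.app b := by
  cases τ with
  | confirm => simp [applyOp]
  | app a => simp [applyOp, eq_comm]
  | del =>
    simp only [applyOp, Prod.mk.injEq, and_true, reduceCtorEq, iff_false]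
    intro h
    have := congrArg List.length h
    simp at this
    omega

theorem applyOp_eq_del_iff {x : List Bool} {b : Bool} {τ : Op} :
    (x, 0) = applyOp (x ++ [b], 0) τ ↔ τ = Op.del := by
  cases τ <;> simp [applyOp]

theorem progress_applyOp (y : List Bool) {s : List Bool × ℕ} {σ : Op} (h : applyOp s σ ≠ s) :
    progress y (applyOp s σ) = progress y s + if applyOp s σ = goodStep y s then 1 else -1 := by
  obtain ⟨x, c⟩ := s
  by_cases hσ : σ = Op.confirm
  · subst hσ
    rw [show applyOp (x, c) Op.confirm = (x, c + 1) by simp only [applyOp]]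
    simp only [goodStep, applyOp_eq_confirm_iff, opy_eq_confirm_iff, progress]
    split_ifs <;> push_cast <;> ring
  cases c with
  | succ c =>
    rw [applyOp_succ hσ, goodStep]
    by_cases hx : x = y
    · have hne : (x, c) ≠ applyOp (x, c + 1) (opy y x) := by
        simp [opy_eq_confirm_iff.2 hx, applyOp]
        omega
      simp only [progress, if_pos hx, if_neg hne]
      push_cast
      ring
    · rw [applyOp_succ (fun ho => hx (opy_eq_confirm_iff.1 ho))]
      simp only [progress, if_neg hx, if_true]
      push_cast
      ring
  | zero =>
    cases σ with
    | confirm => exact absurd rfl hσ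
    | app b =>
      rw [show applyOp (x, 0) (Op.app b) = (x ++ [b], 0) from rfl]
      simp only [goodStep, applyOp_eq_app_iff, opy_eq_app_iff, progress_append_singleton]
    | del =>
      rcases List.eq_nil_or_concat x with rfl | ⟨w, b, rfl⟩
      · simp [applyOp] at h
      · rw [List.concat_eq_append, show applyOp (w ++ [b], 0) Op.del = (w, 0) by simp [applyOp]]
        simp only [goodStep, applyOp_eq_del_iff, opy_eq_del_iff, progress_append_singleton]
        split_ifs <;> ring

theorem progress_eq_sum {y : List Bool} {m : ℕ} {s : ℕ → List Bool × ℕ}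
    (hupd : ∀ i < m, (∃ σ, s (i + 1) = applyOp (s i) σ) ∧ s (i + 1) ≠ s i) :
    progress y (s m) = progress y (s 0) +
      ∑ i ∈ Finset.range m, if s (i + 1) = goodStep y (s i) then (1 : ℤ) else -1 := by
  rw [← sub_eq_iff_eq_add', ← Finset.sum_range_sub (fun i => progress y (s i))]
  refine Finset.sum_congr rfl fun i hi => ?_
  obtain ⟨⟨σ, hσ⟩, hne⟩ := hupd i (Finset.mem_range.1 hi)
  rw [hσ] at hne ⊢
  rw [progress_applyOp y hne, add_sub_cancel_left]


/-- If the final state's string differs from `y` then `g - b ≤ n - 1`; if it equals `y`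
then `g - b = n + c_m`. -/
theorem good_minus_bad_bounds (y : List Bool) (hn : 1 ≤ y.length)
    (m : ℕ) (s : ℕ → List Bool × ℕ)
    (h0 : s 0 = ([], 0))
    (hupd : ∀ i < m, (∃ σ, s (i + 1) = applyOp (s i) σ) ∧ s (i + 1) ≠ s i)
    (g : ℕ)
    (hg : g = ((Finset.range m).filter (fun i => s (i + 1) = goodStep y (s i))).card)
    (b : ℕ) (hb : b = m - g) :
    ((s m).1 ≠ y → (g : ℤ) - (b : ℤ) ≤ (y.length : ℤ) - 1) ∧
      ((s m).1 = y → (g : ℤ) - (b : ℤ) = (y.length : ℤ) + ((s m).2 : ℤ)) := by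
  have hgm : g ≤ m := by
    simpa [hg] using Finset.card_filter_le (Finset.range m) fun i => s (i + 1) = goodStep y (s i)
  have hsum := progress_eq_sum (y := y) hupd
  have hcard := Finset.card_filter_add_card_filter_not (s := Finset.range m)
    fun i => s (i + 1) = goodStep y (s i)
  have hzero : progress y (s 0) = 0 := by simp [h0, progress, lcp]
  have hprog : (g : ℤ) - b = progress y (s m) := by
    rw [hsum, hzero, Finset.sum_ite, Finset.sum_const, Finset.sum_const, ← hg]
    rw [← hg, Finset.card_range] at hcard
    simp only [nsmul_eq_mul]
    omega
  rw [hprog]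
  refine ⟨progress_le_of_ne, fun h => ?_⟩
  rw [← progress_self, ← h]
end

section
/- Every good update decreases D by one and every bad update increases D by one, except at the target: for every state s = (ŷ, c), if ŷ ≠ y then D(goodStep(s)) = D(s) − 1, and if ŷ = y then D(goodStep(s)) = 0; moreover, for every operation σ, if s' = apply s σ satisfies s' ≠ s and s' ≠ goodStep(s), then D(s') = D(s) + 1 or (ŷ = y and (s').1 = y and D(s') = D(s) = 0 fails, i.e., in all cases with ŷ ≠ y one has D(s') = D(s) + 1). -/
/-- `D(yh, c)`: the number of good updates needed to reach the target. -/
def D (y : List Bool) (s : List Bool × ℕ) : ℕ :=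
  if s.1 = y then 0
  else s.2 + (s.1.length - lcp s.1 y) + (y.length - lcp s.1 y)

theorem lcp_append_append (a s t : List Bool) : lcp (a ++ s) (a ++ t) = a.length + lcp s t := by
  induction a with
  | nil => simp
  | cons x a ih => simp [lcp, ih]; omega

theorem lcp_append_right (a t : List Bool) : lcp a (a ++ t) = a.length := by
  simpa [lcp] using lcp_append_append a [] t

theorem lcp_append_left (a t : List Bool) : lcp (a ++ t) a = a.length := by
  simpa [lcp] using lcp_append_append a t []

theorem lcp_self (a : List Bool) : lcp a a = a.length := by
  simpa using lcp_append_right a []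

theorem lcp_le_left (a y : List Bool) : lcp a y ≤ a.length := by
  fun_induction lcp a y <;> simp_all

theorem lcp_append_of_not_isPrefix {a y : List Bool} (h : ¬ a <+: y) (t : List Bool) :
    lcp (a ++ t) y = lcp a y := by
  induction a generalizing y with
  | nil => simp at h
  | cons x a ih =>
    cases y with
    | nil => simp [lcp]
    | cons z y =>
      by_cases hxz : x = z
      · subst hxz
        have h' : ¬ a <+: y := by simpa using h
        simp [lcp, ih h']
      · simp [lcp, hxz]

theorem D_zero_right (y yh : List Bool) :
    D y (yh, 0) = (yh.length - lcp yh y) + (y.length - lcp yh y) := by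
  by_cases h : yh = y
  · subst h; simp [D, lcp_self]
  · simp [D, h]

theorem D_of_ne {y yh : List Bool} (h : yh ≠ y) (c : ℕ) : D y (yh, c) = D y (yh, 0) + c := by
  simp only [D, h, if_false]; omega

theorem D_append_isPrefix (yh t : List Bool) : D (yh ++ t) (yh, 0) = t.length := by
  simp [D_zero_right, lcp_append_right]

theorem D_append_singleton_of_ne {a b : Bool} (h : b ≠ a) (yh t : List Bool) :
    D (yh ++ a :: t) (yh ++ [b], 0) = t.length + 2 := by
  simp [D_zero_right, lcp_append_append, lcp, h]; omega

theorem D_append_singleton_of_not_isPrefix {y yh : List Bool} (h : ¬ yh <+: y) (b : Bool) :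
    D y (yh ++ [b], 0) = D y (yh, 0) + 1 := by
  have := lcp_le_left yh y
  simp only [D_zero_right, lcp_append_of_not_isPrefix h, List.length_append, List.length_singleton]
  omega

theorem D_append_singleton_self (y : List Bool) (b : Bool) : D y (y ++ [b], 0) = 1 := by
  simp [D_zero_right, lcp_append_left]

theorem D_dropLast_of_not_isPrefix {y yh : List Bool} (h : ¬ yh <+: y) :
    D y (yh, 0) = D y (yh.dropLast, 0) + 1 := by
  rcases List.eq_nil_or_concat yh with rfl | ⟨l, b, rfl⟩
  · simp at h
  · rw [List.concat_eq_append] at h ⊢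
    rw [List.dropLast_concat]
    by_cases hl : l <+: y
    · obtain ⟨t, rfl⟩ := hl
      cases t with
      | nil => rw [List.append_nil, D_append_singleton_self, D, if_pos rfl]
      | cons a t =>
        have hba : b ≠ a := by
          rintro rfl
          exact h ⟨t, by simp⟩
        rw [D_append_singleton_of_ne hba, D_append_isPrefix, List.length_cons]
    · exact D_append_singleton_of_not_isPrefix hl b

theorem opy_append_cons (yh t : List Bool) (a : Bool) : opy (yh ++ a :: t) yh = Op.app a := by
  simp [opy]

theorem opy_of_not_isPrefix {y yh : List Bool} (h : ¬ yh <+: y) : opy y yh = Op.del := by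
  have : yh ≠ y := by
    rintro rfl
    exact h List.prefix_rfl
  simp [opy, h, this]

theorem exists_eq_append_cons_or_not_isPrefix {y yh : List Bool} (h : yh ≠ y) :
    (∃ a t, y = yh ++ a :: t) ∨ ¬ yh <+: y := by
  by_cases hp : yh <+: y
  · obtain ⟨t, rfl⟩ := hp
    cases t with
    | nil => simp at h
    | cons a t => exact Or.inl ⟨a, t, rfl⟩
  · exact Or.inr hp

theorem opy_ne_confirm {y yh : List Bool} (h : yh ≠ y) : opy y yh ≠ Op.confirm := by
  rcases exists_eq_append_cons_or_not_isPrefix h with ⟨a, t, rfl⟩ | hp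
  · simp [opy_append_cons]
  · simp [opy_of_not_isPrefix hp]

theorem applyOp_succ_of_ne_confirm {σ : Op} (h : σ ≠ Op.confirm) (yh : List Bool) (c : ℕ) :
    applyOp (yh, c + 1) σ = (yh, c) := by
  cases σ <;> simp_all [applyOp]

theorem D_eq_D_goodStep_add_one {y : List Bool} {s : List Bool × ℕ} (h : s.1 ≠ y) :
    D y s = D y (goodStep y s) + 1 := by
  obtain ⟨yh, _ | c⟩ := s
  · rcases exists_eq_append_cons_or_not_isPrefix h with ⟨a, t, rfl⟩ | hp
    · have := D_append_isPrefix (yh ++ [a]) t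
      simp_all [goodStep, opy_append_cons, applyOp, D_append_isPrefix]
    · simpa [goodStep, opy_of_not_isPrefix hp, applyOp] using D_dropLast_of_not_isPrefix hp
  · simp only [goodStep, applyOp_succ_of_ne_confirm (opy_ne_confirm h)]
    rw [D_of_ne h, D_of_ne h c, add_assoc]

theorem D_applyOp_of_ne_goodStep {y : List Bool} {s : List Bool × ℕ} {σ : Op}
    (hs : applyOp s σ ≠ s) (hg : applyOp s σ ≠ goodStep y s) (h : s.1 ≠ y) :
    D y (applyOp s σ) = D y s + 1 := by
  obtain ⟨yh, c⟩ := s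
  by_cases hσ : σ = Op.confirm
  · subst hσ
    simp only [applyOp]
    rw [D_of_ne h, D_of_ne h c, add_assoc]
  obtain _ | c := c
  · rcases exists_eq_append_cons_or_not_isPrefix h with ⟨a, t, rfl⟩ | hp
    · cases σ with
      | confirm => exact absurd rfl hσ
      | app b =>
        have hba : b ≠ a := by
          rintro rfl
          exact hg (by simp [goodStep, opy_append_cons])
        simp only [applyOp, D_append_singleton_of_ne hba, D_append_isPrefix, List.length_cons]
      | del =>
        rcases List.eq_nil_or_concat yh with rfl | ⟨l, b, rfl⟩
        · simp [applyOp] at hs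
        · have := D_append_isPrefix l (b :: a :: t)
          have := D_append_isPrefix (l ++ [b]) (a :: t)
          simp_all [applyOp]
    · cases σ with
      | confirm => exact absurd rfl hσ
      | app b => exact D_append_singleton_of_not_isPrefix hp b
      | del => exact absurd (by simp [goodStep, opy_of_not_isPrefix hp]) hg
  · refine absurd ?_ hg
    simp only [goodStep, applyOp_succ_of_ne_confirm (opy_ne_confirm h),
      applyOp_succ_of_ne_confirm hσ]

/-- Every good update decreases `D` by one and every bad update increases `D` by one,
except at the target. -/
theorem D_good_bad_update (y : List Bool) (hn : 1 ≤ y.length)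
    (s : List Bool × ℕ) :
    (s.1 ≠ y → (D y (goodStep y s) : ℤ) = (D y s : ℤ) - 1) ∧
      (s.1 = y → D y (goodStep y s) = 0) ∧
      (∀ σ : Op, applyOp s σ ≠ s → applyOp s σ ≠ goodStep y s → s.1 ≠ y →
        D y (applyOp s σ) = D y s + 1) := by
  refine ⟨fun h => ?_, fun h => ?_, fun σ hs hg h => D_applyOp_of_ne_goodStep hs hg h⟩
  · rw [D_eq_D_goodStep_add_one h]
    push_cast
    ring
  · subst h
    simp [goodStep, opy, applyOp, D]
end
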